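/- For every complex number q with |q| < 1, (1 + q) \sum_{n=0}^{\infty} (-q; q^2)_n q^{2n} / (q^2; q^2)_n = (-q; q^2)_{\infty} / (q^2; q^2)_{\infty}, i.e. (1 + q) \sum_{n=0}^{\infty} \left( \prod_{j=0}^{n-1} (1 + q^{2j+1}) \right) q^{2n} / \prod_{j=0}^{n-1} (1 - q^{2j+2}) = \prod_{j=0}^{\infty} (1 + q^{2j+1}) / \prod_{j=0}^{\infty} (1 - q^{2j+2}). -/

import Mathlib

theorem one_sub_pow_ne_zero_of_norm_lt_one {q : ℂ} (hq : ‖q‖ < 1) {n : ℕ} (hn : n ≠ 0) :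
    1 - q ^ n ≠ 0 := by
  intro h
  have h1 : ‖q ^ n‖ < 1 := by
    rw [norm_pow]
    exact pow_lt_one₀ (norm_nonneg q) hq hn
  rw [← sub_eq_zero.mp h] at h1
  simp at h1

theorem summable_norm_pow_two_mul_add {q : ℂ} (hq : ‖q‖ < 1) (k : ℕ) :
    Summable fun j : ℕ => ‖q ^ (2 * j + k)‖ := by
  have h : ‖q‖ ^ 2 < 1 := pow_lt_one₀ (norm_nonneg q) hq two_ne_zero
  have hs := (summable_geometric_of_lt_one (by positivity) h).mul_right (‖q‖ ^ k)
  refine hs.congr fun j => ?_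
  rw [norm_pow, pow_add, pow_mul]

theorem one_add_q_mul_sum_range {q : ℂ} (hq : ‖q‖ < 1) (N : ℕ) :
    (1 + q) * ∑ n ∈ Finset.range N,
        (∏ j ∈ Finset.range n, (1 + q ^ (2 * j + 1))) * q ^ (2 * n) /
          ∏ j ∈ Finset.range n, (1 - q ^ (2 * j + 2)) =
      (∏ j ∈ Finset.range N, (1 + q ^ (2 * j + 1))) /
        (∏ j ∈ Finset.range N, (1 - q ^ (2 * j + 2))) * (1 - q ^ (2 * N)) := by
  induction N with
  | zero => simp
  | succ N ih =>
    have hN : 1 - q ^ (2 * N + 2) ≠ 0 := one_sub_pow_ne_zero_of_norm_lt_one hq (by omega)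
    have hP : ∏ j ∈ Finset.range N, (1 - q ^ (2 * j + 2)) ≠ 0 :=
      Finset.prod_ne_zero_iff.mpr fun j _ => one_sub_pow_ne_zero_of_norm_lt_one hq (by omega)
    rw [Finset.sum_range_succ, mul_add, ih, Finset.prod_range_succ, Finset.prod_range_succ,
      show 2 * (N + 1) = 2 * N + 2 by ring]
    field_simp
    ring

theorem one_add_q_mul_sum (q : ℂ) (hq : ‖q‖ < 1) :
    (1 + q) * ∑' n : ℕ,
        (∏ j ∈ Finset.range n, (1 + q ^ (2 * j + 1))) * q ^ (2 * n) /
          ∏ j ∈ Finset.range n, (1 - q ^ (2 * j + 2)) =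
      (∏' j : ℕ, (1 + q ^ (2 * j + 1))) / ∏' j : ℕ, (1 - q ^ (2 * j + 2)) := by
  have hden : Summable fun j : ℕ => ‖-q ^ (2 * j + 2)‖ := by
    simpa only [norm_neg] using summable_norm_pow_two_mul_add hq 2
  have hA := (multipliable_one_add_of_summable
    (summable_norm_pow_two_mul_add hq 1)).hasProd.tendsto_prod_nat
  have hB := (multipliable_one_add_of_summable hden).hasProd.tendsto_prod_nat
  have hB0 : ∏' j : ℕ, (1 + -q ^ (2 * j + 2)) ≠ 0 :=
    tprod_one_add_ne_zero_of_summable (fun j => by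
      rw [← sub_eq_add_neg]
      exact one_sub_pow_ne_zero_of_norm_lt_one hq (by omega)) hden
  simp only [← sub_eq_add_neg] at hB hB0
  have hAB := hA.div hB hB0
  have hsq : Summable fun n : ℕ => ‖q ^ (2 * n)‖ := summable_norm_pow_two_mul_add hq 0
  have hsum : Summable fun n : ℕ =>
      (∏ j ∈ Finset.range n, (1 + q ^ (2 * j + 1))) * q ^ (2 * n) /
        ∏ j ∈ Finset.range n, (1 - q ^ (2 * j + 2)) := by
    refine summable_of_isBigO_nat hsq ?_
    have h := (hAB.isBigO_one ℝ).mul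
      (Asymptotics.isBigO_refl (fun n : ℕ => q ^ (2 * n)) Filter.atTop).norm_right
    simp only [one_mul] at h
    exact h.congr_left fun n => by simp only [Pi.div_apply]; ring
  have hq0 : Filter.Tendsto (fun n : ℕ => 1 - q ^ (2 * n)) Filter.atTop (nhds 1) := by
    simpa using hsq.of_norm.tendsto_atTop_zero.const_sub 1
  have hlim := hAB.mul hq0
  rw [mul_one] at hlim
  refine tendsto_nhds_unique (hsum.hasSum.tendsto_sum_nat.const_mul (1 + q)) ?_
  exact hlim.congr fun N => (one_add_q_mul_sum_range hq N).symm
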